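/- For n ≥ 3, let w′ be the word (n−1), n, (n−2), (n−1), (n−3), (n−2), …, 3, 4, 2, 3, 1, 2; formally, w′ is the concatenation, for k = n down to 2, of the two-letter factor (k−1)k. Then w′ is 132-avoiding and w′ represents the cycle graph C_n on vertex set {1, 2, …, n} whose edges are exactly the pairs {i, i+1} for 1 ≤ i ≤ n−1 together with the pair {1, n}. -/

import Mathlib

/-- Distinct letters `x` and `y` alternate in the word `w`: the subsequence of `w`
formed by all occurrences of `x` and `y` has no two equal consecutive letters. -/
def Alternate (w : List ℕ) (x y : ℕ) : Prop :=
  (w.filter (fun c => decide (c = x ∨ c = y))).Chain' (· ≠ ·)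

/-- The word `w` avoids the pattern 132. -/
def Avoids132 (w : List ℕ) : Prop :=
  ∀ i j k : Fin w.length, i < j → j < k →
    ¬ (w.get i < w.get k ∧ w.get k < w.get j)

/-- The word `w` represents the simple graph `G`: the vertex set of `G` is the set
`A(w)` of letters of `w` (all other vertices of the ambient type `ℕ` are isolated),
and two distinct letters of `w` are adjacent iff they alternate in `w`. -/
def Represents (w : List ℕ) (G : SimpleGraph ℕ) : Prop :=
  (∀ x y, G.Adj x y → x ∈ w) ∧
  (∀ x y : ℕ, x ≠ y → x ∈ w → y ∈ w → (G.Adj x y ↔ Alternate w x y))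

/-- A graph is 132-representable if some simple graph on a set of natural numbers
isomorphic to it is represented by a 132-avoiding word. -/
def Representable132 {V : Type*} (G : SimpleGraph V) : Prop :=
  ∃ (w : List ℕ) (H : SimpleGraph ℕ), Avoids132 w ∧ Represents w H ∧
    Nonempty (G ≃g H.induce (↑w.toFinset : Set ℕ))

/-- The cycle graph `C n` on vertex set `{1, …, n}`, whose edges are exactly the
pairs `{i, i+1}` for `1 ≤ i ≤ n - 1` together with `{1, n}` (all other vertices
of `ℕ` are isolated). -/
def cycleGraphOn (n : ℕ) : SimpleGraph ℕ :=
  SimpleGraph.fromRel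
    (fun x y => (1 ≤ x ∧ x ≤ n - 1 ∧ y = x + 1) ∨ (x = 1 ∧ y = n))

/-- The word `(n-1) n (n-2) (n-1) (n-3) (n-2) ⋯ 3 4 2 3 1 2`: the concatenation of
the factors `(k-1) k` for `k = n` down to `2`. -/
def cycleWord (n : ℕ) : List ℕ :=
  (List.range (n - 1)).flatMap (fun j => [n - 1 - j, n - j])

theorem cycleWord_succ_succ (m : ℕ) :
    cycleWord (m + 2) = (m + 1) :: (m + 2) :: cycleWord (m + 1) := by
  simp only [cycleWord, Nat.add_sub_cancel, show m + 2 - 1 = m + 1 from rfl,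
    List.range_succ_eq_map, List.flatMap_cons, List.flatMap_map]
  simp only [List.cons_append, List.nil_append, Nat.sub_zero, List.cons.injEq, true_and]
  congr 1
  funext j
  simp only [List.cons.injEq, and_true]
  omega

theorem mem_cycleWord {m a : ℕ} : a ∈ cycleWord (m + 2) ↔ 1 ≤ a ∧ a ≤ m + 2 := by
  induction m with
  | zero =>
    rw [cycleWord_succ_succ]
    simp [cycleWord]
    omega
  | succ m ih =>
    rw [cycleWord_succ_succ, List.mem_cons, List.mem_cons, ih]
    omega

theorem getElem?_cycleWord {m i a : ℕ} (h : (cycleWord (m + 1))[i]? = some a) :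
    a + i / 2 = m + i % 2 := by
  induction m generalizing i with
  | zero => simp [cycleWord] at h
  | succ m ih =>
    rw [cycleWord_succ_succ] at h
    match i with
    | 0 => simp at h; omega
    | 1 => simp at h; omega
    | i + 2 =>
      have := ih (i := i) (by simpa using h)
      omega

theorem avoids132_cycleWord (m : ℕ) : Avoids132 (cycleWord (m + 1)) := by
  rintro ⟨i, hi⟩ ⟨j, hj⟩ ⟨k, hk⟩ hij hjk ⟨hik, -⟩
  have h₁ := getElem?_cycleWord (List.getElem?_eq_getElem hi)
  have h₂ := getElem?_cycleWord (List.getElem?_eq_getElem hk)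
  simp only [Fin.mk_lt_mk, List.get_eq_getElem] at hij hjk hik
  omega

/-- Letters smaller than both `x` and `y` do not contribute. -/
theorem filter_cycleWord_of_lt {x y m : ℕ} (hx : m + 1 < x) (hy : m + 1 < y) :
    (cycleWord (m + 1)).filter (fun c => decide (c = x ∨ c = y)) = [] := by
  induction m with
  | zero => simp [cycleWord]
  | succ m ih =>
    rw [cycleWord_succ_succ]
    grind

/-- Letters larger than both `x` and `y` do not contribute. -/
theorem filter_cycleWord_of_gt {x y m d : ℕ} (hx : x < m + 1) (hy : y < m + 1) :
    (cycleWord (m + d + 1)).filter (fun c => decide (c = x ∨ c = y)) =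
      (cycleWord (m + 1)).filter (fun c => decide (c = x ∨ c = y)) := by
  induction d with
  | zero => rfl
  | succ d ih =>
    rw [show m + (d + 1) + 1 = (m + d) + 2 by ring, cycleWord_succ_succ]
    grind

/-- In the suffix with largest letter `x + 1`, only `x + 1` occurs among `x + 1 < y + 1`. -/
theorem filter_cycleWord_self {x y : ℕ} (hxy : x < y) :
    (cycleWord (x + 1)).filter (fun c => decide (c = x + 1 ∨ c = y + 1)) =
      if x = 0 then [] else [x + 1] := by
  cases x with
  | zero => simp [cycleWord]
  | succ x =>
    rw [cycleWord_succ_succ]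
    have := filter_cycleWord_of_lt (x := x + 1 + 1) (y := y + 1) (m := x) (by omega) (by omega)
    grind

theorem alternate_iff_isChain {w : List ℕ} {x y : ℕ} :
    Alternate w x y ↔ (w.filter (fun c => decide (c = x ∨ c = y))).IsChain (· ≠ ·) :=
  Iff.rfl

theorem alternate_succ (x m : ℕ) (h : x + 2 ≤ m + 2) :
    Alternate (cycleWord (m + 2)) (x + 1) (x + 2) := by
  have h₁ : (cycleWord (x + 2)).filter (fun c => decide (c = x + 1 ∨ c = x + 2)) =
      (x + 1) :: (x + 2) :: if x = 0 then [] else [x + 1] := by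
    have := filter_cycleWord_self (x := x) (y := x + 1) (by omega)
    rw [cycleWord_succ_succ]
    grind
  rw [alternate_iff_isChain]
  obtain h | h := h.eq_or_lt
  · rw [← h, h₁]
    split_ifs <;> simp
  · obtain ⟨d, rfl⟩ : ∃ d, m = x + 1 + d := ⟨m - (x + 1), by omega⟩
    have h₂ : (cycleWord (x + 3)).filter (fun c => decide (c = x + 1 ∨ c = x + 2)) =
        (x + 2) :: (x + 1) :: (x + 2) :: if x = 0 then [] else [x + 1] := by
      rw [cycleWord_succ_succ]
      grind
    rw [show x + 1 + d + 2 = (x + 2) + d + 1 by ring,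
      filter_cycleWord_of_gt (by omega) (by omega), h₂]
    split_ifs <;> simp

/-- The suffix with largest letter strictly between `x + 1` and `y + 1` contains every occurrence
of `x + 1` and none of `y + 1`. -/
theorem filter_cycleWord_between {x y d : ℕ} (h : x + d + 1 < y) :
    (cycleWord (x + d + 2)).filter (fun c => decide (c = x + 1 ∨ c = y + 1)) =
      (x + 1) :: if x = 0 then [] else [x + 1] := by
  induction d with
  | zero =>
    have := filter_cycleWord_self (x := x) (y := y) (by omega)
    rw [add_zero, cycleWord_succ_succ]
    grind
  | succ d ih =>
    have := ih (by omega)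
    rw [show x + (d + 1) + 2 = (x + d + 1) + 2 by ring, cycleWord_succ_succ]
    grind

theorem alternate_iff_of_add_two_le {x d m : ℕ} (h : x + d + 3 ≤ m + 2) :
    Alternate (cycleWord (m + 2)) (x + 1) (x + d + 3) ↔ x = 0 ∧ x + d + 3 = m + 2 := by
  have h₁ : (cycleWord (x + d + 3)).filter (fun c => decide (c = x + 1 ∨ c = x + d + 3)) =
      (x + d + 3) :: (x + 1) :: if x = 0 then [] else [x + 1] := by
    have := filter_cycleWord_between (x := x) (y := x + d + 2) (d := d) (by omega)
    rw [cycleWord_succ_succ]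
    grind
  rw [alternate_iff_isChain]
  obtain h | h := h.eq_or_lt
  · rw [← h, h₁]
    split_ifs <;> simp <;> omega
  · obtain ⟨e, rfl⟩ : ∃ e, m = x + d + 2 + e := ⟨m - (x + d + 2), by omega⟩
    have h₂ : (cycleWord (x + d + 4)).filter (fun c => decide (c = x + 1 ∨ c = x + d + 3)) =
        (x + d + 3) :: (x + d + 3) :: (x + 1) :: if x = 0 then [] else [x + 1] := by
      rw [cycleWord_succ_succ]
      grind
    rw [show x + d + 2 + e + 2 = (x + d + 3) + e + 1 by ring,
      filter_cycleWord_of_gt (by omega) (by omega), h₂]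
    simp
    omega

theorem Alternate.symm {w : List ℕ} {x y : ℕ} (h : Alternate w x y) : Alternate w y x := by
  rw [alternate_iff_isChain] at *
  simpa only [or_comm] using h

theorem cycleGraphOn_adj_iff_alternate_of_lt {m x y : ℕ} (hxy : x < y) (hx : 1 ≤ x)
    (hy : y ≤ m + 2) (hm : 1 ≤ m) :
    (cycleGraphOn (m + 2)).Adj x y ↔ Alternate (cycleWord (m + 2)) x y := by
  obtain ⟨x, rfl⟩ := Nat.exists_eq_add_of_le' hx
  simp only [cycleGraphOn, SimpleGraph.fromRel_adj]
  obtain rfl | h : y = x + 2 ∨ x + 3 ≤ y := by omega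
  · exact iff_of_true ⟨by omega, Or.inl (Or.inl ⟨by omega, by omega, rfl⟩)⟩
      (alternate_succ x m hy)
  · obtain ⟨d, rfl⟩ : ∃ d, y = x + d + 3 := ⟨y - (x + 3), by omega⟩
    rw [alternate_iff_of_add_two_le hy]
    omega

/-- For `n ≥ 3`, the word `cycleWord n` is 132-avoiding, has letter set
`{1, …, n}`, and represents the cycle graph `C n` on `{1, …, n}`. -/
theorem cycleWord_represents (n : ℕ) (hn : 3 ≤ n) :
    Avoids132 (cycleWord n) ∧ (cycleWord n).toFinset = Finset.Icc 1 n ∧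
    Represents (cycleWord n) (cycleGraphOn n) := by
  obtain ⟨m, rfl⟩ := Nat.exists_eq_add_of_le' (show 2 ≤ n by omega)
  refine ⟨avoids132_cycleWord (m + 1), ?_, ?_, ?_⟩
  · ext a
    rw [List.mem_toFinset, mem_cycleWord, Finset.mem_Icc]
  · intro x y h
    rw [mem_cycleWord]
    simp only [cycleGraphOn, SimpleGraph.fromRel_adj] at h
    omega
  · intro x y hxy hx hy
    rw [mem_cycleWord] at hx hy
    obtain h | h := hxy.lt_or_gt
    · exact cycleGraphOn_adj_iff_alternate_of_lt h hx.1 hy.2 (by omega)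
    · rw [SimpleGraph.adj_comm,
        cycleGraphOn_adj_iff_alternate_of_lt h hy.1 hx.2 (by omega)]
      exact ⟨Alternate.symm, Alternate.symm⟩
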